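/- For the weighted path P_{n,k} with n, k ≥ 1 and k ≥ (11 − 2n)/3, Mcut(P_{n,k}) equals: 4/(3k + 2n − 2) if (3 | n and 2 | k and k > 2n/3 + 2) or ((3k+2n)/4 ∈ ℤ and k ≤ 2n/3); 4(3k + 2n − 2)/((3k + 2n − 5)(3k + 2n + 1)) if 3 | n and 2 ∤ k and k > 2n/3 + 2; 4(3k + 2n − 2)/((3k + 2n − 4)(3k + 2n)) if (3 ∤ n and 2 | k and k > 2n/3 + 2) or ((3k+2n)/4 ∉ ℤ and 2 | k and k ≤ 2n/3); 4(3k + 2n − 2)/((3k + 2n − 3)(3k + 2n − 1)) if (3 ∤ n and 2 ∤ k and k > 2n/3 + 2) or (2 ∤ k and k ≤ 2n/3); (3k + 2n − 2)/((3k − 1)(2n − 1)) if 2n/3 < k ≤ 2n/3 + 1; and (2 − 3k − 2n)/(8 − 6k + 8n − 6kn) if 2n/3 + 1 < k ≤ 2n/3 + 2. -/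

import Mathlib

open Finset

/-- The degree of vertex `i` in a weighted graph with weight matrix `W`. -/
noncomputable def wdeg {V : Type} [Fintype V] (W : Matrix V V ℝ) (i : V) : ℝ := ∑ j, W i j

/-- `vol(A) = ∑_{i ∈ A} d_i`. -/
noncomputable def wvol {V : Type} [Fintype V] (W : Matrix V V ℝ) (A : Finset V) : ℝ :=
  ∑ i ∈ A, wdeg W i

/-- `cut(A, V∖A) = ∑_{i ∈ A, j ∉ A} w_{ij}`. -/
noncomputable def wcut {V : Type} [Fintype V] [DecidableEq V] (W : Matrix V V ℝ)
    (A : Finset V) : ℝ :=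
  ∑ i ∈ A, ∑ j ∈ Aᶜ, W i j

/-- The normalized cut `Ncut(A, V∖A) = cut(A,V∖A)·(1/vol(A) + 1/vol(V∖A))`. -/
noncomputable def wncut {V : Type} [Fintype V] [DecidableEq V] (W : Matrix V V ℝ)
    (A : Finset V) : ℝ :=
  wcut W A * (1 / wvol W A + 1 / wvol W Aᶜ)

/-- The minimum normalized cut `Mcut(G)`: the minimum of `Ncut(A, V∖A)` over all
nonempty proper subsets `A` of the vertex set. -/
noncomputable def wmcut {V : Type} [Fintype V] [DecidableEq V] (W : Matrix V V ℝ) : ℝ :=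
  sInf {x : ℝ | ∃ A : Finset V, A.Nonempty ∧ Aᶜ.Nonempty ∧ x = wncut W A}

/-- The weight matrix of the weighted path `P_{n,k}`: a path on `n + k` vertices with
unit edge weights, together with a self-loop of weight `1` at each of the last `k`
vertices. -/
noncomputable def wpathW (n k : ℕ) : Matrix (Fin (n + k)) (Fin (n + k)) ℝ :=
  Matrix.of fun i j =>
    (if i.val + 1 = j.val ∨ j.val + 1 = i.val then 1 else 0) +
      (if i = j ∧ n ≤ i.val then 1 else 0)

lemma wpathW_apply (n k : ℕ) (i j : Fin (n + k)) :
    wpathW n k i j = (if i.val + 1 = j.val ∨ j.val + 1 = i.val then 1 else 0) +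
      (if i = j ∧ n ≤ i.val then 1 else 0) := rfl

lemma wpathW_nonneg (n k : ℕ) (i j : Fin (n + k)) : 0 ≤ wpathW n k i j := by
  rw [wpathW_apply]
  positivity

lemma wpathW_comm (n k : ℕ) (i j : Fin (n + k)) : wpathW n k i j = wpathW n k j i := by
  simp only [wpathW_apply, Fin.ext_iff]
  congr 1 <;> congr 1 <;> apply propext <;> omega

lemma Fin.sum_ite_val_eq {N : ℕ} (a : ℕ) :
    ∑ j : Fin N, (if j.val = a then (1 : ℝ) else 0) = if a < N then 1 else 0 := by
  rw [Fin.sum_univ_eq_sum_range (fun j => if j = a then (1 : ℝ) else 0), Finset.sum_ite_eq']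
  simp

lemma wdeg_wpathW (n k : ℕ) (i : Fin (n + k)) :
    wdeg (wpathW n k) i = (if i.val + 1 < n + k then 1 else 0) + (if 0 < i.val then 1 else 0) +
      (if n ≤ i.val then 1 else 0) := by
  have hi := i.isLt
  have hsplit (j : Fin (n + k)) : wpathW n k i j =
      (if j.val = i.val + 1 then 1 else 0) +
        (if 0 < i.val then (if j.val = i.val - 1 then 1 else 0) else 0) +
        (if n ≤ i.val then (if j.val = i.val then 1 else 0) else 0) := by
    simp only [wpathW_apply, Fin.ext_iff]
    split_ifs <;> first | omega | norm_num
  have hprev : i.val - 1 < n + k := by omega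
  simp only [wdeg, hsplit, Finset.sum_add_distrib, Fin.sum_ite_val_eq]
  congr 1
  · congr 1
    split_ifs
    · rw [Fin.sum_ite_val_eq, if_pos hprev]
    · simp
  · split_ifs
    · rw [Fin.sum_ite_val_eq, if_pos hi]
    · simp

/-- The first `m` vertices of a path on `N` vertices. -/
def pathPrefix (N m : ℕ) : Finset (Fin N) := univ.filter fun i => i.val < m

@[simp]
lemma mem_pathPrefix {N m : ℕ} {i : Fin N} : i ∈ pathPrefix N m ↔ i.val < m := by
  simp [pathPrefix]

lemma wvol_pathPrefix {n k m : ℕ} (hn : 1 ≤ n) (hk : 1 ≤ k) (hm : 1 ≤ m) (hmN : m ≤ n + k) :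
    wvol (wpathW n k) (pathPrefix (n + k) m) =
      2 * m - 1 + ((m - n : ℕ) : ℝ) - (if m = n + k then 1 else 0) := by
  induction m, hm using Nat.le_induction with
  | base =>
    have h0 : pathPrefix (n + k) 1 = {⟨0, by omega⟩} := by
      ext i
      simp [Fin.ext_iff]
    rw [h0, wvol, Finset.sum_singleton, wdeg_wpathW]
    have h1 : 1 - n = 0 := by omega
    have h2 : 1 < n + k := by omega
    have h3 : n ≠ 0 := by omega
    have h4 : 1 ≠ n + k := by omega
    simp [h1, h2, h3, h4]
    norm_num
  | succ m hm ih =>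
    have hins : pathPrefix (n + k) (m + 1) =
        insert ⟨m, by omega⟩ (pathPrefix (n + k) m) := by
      ext i
      simp [Fin.ext_iff]
      omega
    have hvol : wvol (wpathW n k) (pathPrefix (n + k) (m + 1)) =
        wdeg (wpathW n k) ⟨m, by omega⟩ + wvol (wpathW n k) (pathPrefix (n + k) m) := by
      rw [hins, wvol, Finset.sum_insert (by simp)]
      rfl
    rw [hvol, ih (by omega), wdeg_wpathW]
    have h1 : m ≠ n + k := by omega
    have h2 : 0 < m := hm
    simp only [h1, h2, if_true, if_false]
    by_cases h3 : n ≤ m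
    · have h4 : m + 1 - n = (m - n) + 1 := by omega
      rw [h4, if_pos h3]
      push_cast
      split_ifs <;> first | omega | ring
    · have h4 : m + 1 - n = 0 := by omega
      have h5 : m - n = 0 := by omega
      rw [h4, h5, if_neg h3]
      push_cast
      split_ifs <;> first | omega | ring

lemma wvol_add_wvol_compl {n k : ℕ} (hn : 1 ≤ n) (hk : 1 ≤ k) (A : Finset (Fin (n + k))) :
    wvol (wpathW n k) A + wvol (wpathW n k) Aᶜ = 3 * (k : ℝ) + 2 * n - 2 := by
  have huniv : pathPrefix (n + k) (n + k) = univ := by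
    ext i
    simp
  have hvol := wvol_pathPrefix (m := n + k) hn hk (by omega) le_rfl
  rw [huniv, if_pos rfl, Nat.add_sub_cancel_left] at hvol
  push_cast at hvol
  rw [wvol, wvol, Finset.sum_add_sum_compl]
  rw [wvol] at hvol
  linarith

lemma wvol_wpathW_pos {n k : ℕ} (hn : 1 ≤ n) (hk : 1 ≤ k) {A : Finset (Fin (n + k))}
    (hA : A.Nonempty) : 0 < wvol (wpathW n k) A := by
  refine Finset.sum_pos (fun i _ => ?_) hA
  rw [wdeg_wpathW]
  split_ifs <;> first | omega | norm_num

lemma wcut_compl {V : Type} [Fintype V] [DecidableEq V] {W : Matrix V V ℝ}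
    (hW : ∀ i j, W i j = W j i) (A : Finset V) : wcut W Aᶜ = wcut W A := by
  unfold wcut
  rw [compl_compl]
  refine Finset.sum_comm.trans ?_
  exact Finset.sum_congr rfl fun i _ => Finset.sum_congr rfl fun j _ => hW j i

lemma wncut_compl {V : Type} [Fintype V] [DecidableEq V] {W : Matrix V V ℝ}
    (hW : ∀ i j, W i j = W j i) (A : Finset V) : wncut W Aᶜ = wncut W A := by
  rw [wncut, wncut, wcut_compl hW, compl_compl, add_comm]

lemma wcut_pathPrefix {n k m : ℕ} (hm : 1 ≤ m) (hmN : m < n + k) :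
    wcut (wpathW n k) (pathPrefix (n + k) m) = 1 := by
  rw [wcut, Finset.sum_eq_single_of_mem ⟨m - 1, by omega⟩ (by simp; omega),
    Finset.sum_eq_single_of_mem ⟨m, hmN⟩ (by simp)]
  · rw [wpathW_apply, if_pos (by simp; omega), if_neg (by simp [Fin.ext_iff]; omega)]
    norm_num
  · intro j hj hne
    simp only [mem_compl, mem_pathPrefix, ne_eq, Fin.ext_iff] at hj hne
    rw [wpathW_apply, if_neg (by simp; omega), if_neg (by simp [Fin.ext_iff]; omega), add_zero]
  · intro i hi hne
    refine Finset.sum_eq_zero fun j hj => ?_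
    simp only [mem_compl, mem_pathPrefix, ne_eq, Fin.ext_iff] at hi hj hne
    rw [wpathW_apply, if_neg (by omega), if_neg (by simp only [Fin.ext_iff]; omega), add_zero]

/-- A vertex set containing the first vertex is an initial segment, or its cut is at least `2`. -/
lemma eq_pathPrefix_or_two_le_wcut {n k : ℕ} {A : Finset (Fin (n + k))} (hA : Aᶜ.Nonempty)
    (h0 : ∀ i : Fin (n + k), i.val = 0 → i ∈ A) :
    (∃ m, 1 ≤ m ∧ m < n + k ∧ A = pathPrefix (n + k) m) ∨ 2 ≤ wcut (wpathW n k) A := by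
  obtain ⟨m, hm, hmin⟩ := Finset.exists_min_image Aᶜ id hA
  simp only [mem_compl, id] at hm hmin
  have hmpos : 0 < m.val := Nat.pos_of_ne_zero fun h => hm (h0 m h)
  have hlt (i : Fin (n + k)) (hi : i < m) : i ∈ A := by
    by_contra hiA
    exact absurd (hmin i hiA) (not_le.2 hi)
  by_cases hpre : ∀ i ∈ A, i < m
  · refine Or.inl ⟨m, hmpos, m.isLt, ?_⟩
    ext i
    simpa using ⟨hpre i, hlt i⟩
  refine Or.inr ?_
  push Not at hpre
  obtain ⟨i, hi, hmi⟩ := hpre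
  obtain ⟨j, hj, hjmin⟩ := Finset.exists_min_image (A.filter fun i => m ≤ i) id
    ⟨i, by simp [hi, hmi]⟩
  simp only [mem_filter, id, and_imp] at hj hjmin
  have hmj : m.val < j.val :=
    lt_of_le_of_ne hj.2 fun h => hm (by rw [Fin.ext h]; exact hj.1)
  let m' : Fin (n + k) := ⟨m - 1, by omega⟩
  let j' : Fin (n + k) := ⟨j - 1, by omega⟩
  have hm' : m' ∈ A := hlt m' (by simp only [Fin.lt_def, m']; omega)
  have hj' : j' ∉ A := fun h => by
    have := hjmin j' h (by simp only [Fin.le_def, j']; omega)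
    simp only [Fin.le_def, j'] at this
    omega
  have hne : (m', m) ≠ (j, j') := by
    simp only [ne_eq, Prod.ext_iff, Fin.ext_iff, m', j']
    omega
  have hsub : ({(m', m), (j, j')} : Finset _) ⊆ A ×ˢ Aᶜ := by
    intro p hp
    simp only [mem_insert, mem_singleton] at hp
    rcases hp with rfl | rfl <;> simp [hm, hm', hj.1, hj']
  have hW1 : wpathW n k m' m = 1 := by
    rw [wpathW_apply, if_pos (by simp only [m']; omega),
      if_neg (by simp only [m', Fin.ext_iff]; omega), add_zero]
  have hW2 : wpathW n k j j' = 1 := by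
    rw [wpathW_apply, if_pos (by simp only [j']; omega),
      if_neg (by simp only [j', Fin.ext_iff]; omega), add_zero]
  calc (2 : ℝ) = ∑ p ∈ {(m', m), (j, j')}, wpathW n k p.1 p.2 := by
        rw [Finset.sum_pair hne, hW1, hW2]
        norm_num
    _ ≤ ∑ p ∈ A ×ˢ Aᶜ, wpathW n k p.1 p.2 :=
        Finset.sum_le_sum_of_subset_of_nonneg hsub fun p _ _ => wpathW_nonneg n k _ _
    _ = wcut (wpathW n k) A := Finset.sum_product _ _ _

/-- The difference between the volumes of the two sides of the cut after the first `m`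
vertices of `P_{n,k}`. -/
def pathImbalance (n k m : ℕ) : ℤ :=
  if m ≤ n then 3 * k + 2 * n - 4 * m else 3 * k + 4 * n - 6 * m

lemma wncut_pathPrefix {n k m : ℕ} (hn : 1 ≤ n) (hk : 1 ≤ k) (hm : 1 ≤ m) (hmN : m < n + k) :
    wncut (wpathW n k) (pathPrefix (n + k) m) = 4 * (3 * (k : ℝ) + 2 * n - 2) /
      ((3 * (k : ℝ) + 2 * n - 2) ^ 2 - (pathImbalance n k m : ℝ) ^ 2) := by
  have hpos : 0 < wvol (wpathW n k) (pathPrefix (n + k) m) :=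
    wvol_wpathW_pos hn hk ⟨⟨0, by omega⟩, by simp; omega⟩
  have hpos' : 0 < wvol (wpathW n k) (pathPrefix (n + k) m)ᶜ :=
    wvol_wpathW_pos hn hk ⟨⟨m, hmN⟩, by simp⟩
  have hsum := wvol_add_wvol_compl hn hk (pathPrefix (n + k) m)
  have hdiff : wvol (wpathW n k) (pathPrefix (n + k) m)ᶜ -
      wvol (wpathW n k) (pathPrefix (n + k) m) = pathImbalance n k m := by
    have hvol := wvol_pathPrefix hn hk hm hmN.le
    rw [if_neg hmN.ne] at hvol
    rw [pathImbalance]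
    split_ifs with h
    · rw [Nat.sub_eq_zero_of_le h] at hvol
      push_cast at hvol ⊢
      linarith
    · rw [Nat.cast_sub (by omega)] at hvol
      push_cast
      linarith
  rw [wncut, wcut_pathPrefix hm hmN, ← hdiff, ← hsum]
  generalize wvol (wpathW n k) (pathPrefix (n + k) m) = a at *
  generalize wvol (wpathW n k) (pathPrefix (n + k) m)ᶜ = b at *
  have hden : (a + b) ^ 2 - (b - a) ^ 2 = 4 * (a * b) := by ring
  rw [hden]
  field_simp
  ring

lemma le_wncut_of_two_le_wcut {n k : ℕ} (hn : 1 ≤ n) (hk : 1 ≤ k) {A : Finset (Fin (n + k))}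
    (hA : A.Nonempty) (hA' : Aᶜ.Nonempty) (hcut : 2 ≤ wcut (wpathW n k) A) :
    8 / (3 * (k : ℝ) + 2 * n - 2) ≤ wncut (wpathW n k) A := by
  have ha := wvol_wpathW_pos hn hk hA
  have hb := wvol_wpathW_pos hn hk hA'
  rw [wncut, ← wvol_add_wvol_compl hn hk A]
  generalize wvol (wpathW n k) A = a at *
  generalize wvol (wpathW n k) Aᶜ = b at *
  calc 8 / (a + b) ≤ 2 * (1 / a + 1 / b) := by
        rw [div_add_div _ _ ha.ne' hb.ne', mul_div_assoc', div_le_div_iff₀ (by positivity)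
          (by positivity)]
        nlinarith [sq_nonneg (a - b)]
    _ ≤ _ := by gcongr

/-- The minimum normalized cut of `P_{n,k}` is attained by the most balanced initial segment,
provided that this segment is balanced up to `3`. -/
lemma wmcut_wpathW {n k m : ℕ} {δ : ℤ} (hn : 1 ≤ n) (hk : 1 ≤ k) (h : 11 ≤ 3 * k + 2 * n)
    (hm : 1 ≤ m) (hmN : m < n + k) (hδm : (pathImbalance n k m).natAbs = δ.natAbs)
    (hδ : δ.natAbs ≤ 3)
    (hmin : ∀ l, 1 ≤ l → l < n + k → δ.natAbs ≤ (pathImbalance n k l).natAbs) :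
    wmcut (wpathW n k) = 4 * (3 * (k : ℝ) + 2 * n - 2) /
      ((3 * (k : ℝ) + 2 * n - 2 - δ) * (3 * (k : ℝ) + 2 * n - 2 + δ)) := by
  have hV : (9 : ℝ) ≤ 3 * (k : ℝ) + 2 * n - 2 := by
    have : (11 : ℝ) ≤ 3 * k + 2 * n := by exact_mod_cast h
    linarith
  have hδ9 : (δ : ℝ) ^ 2 ≤ 9 := by
    have : δ ^ 2 ≤ 3 ^ 2 := Int.natAbs_le_iff_sq_le.1 hδ
    exact_mod_cast this
  have hsq : (pathImbalance n k m : ℝ) ^ 2 = (δ : ℝ) ^ 2 := by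
    exact_mod_cast Int.natAbs_eq_iff_sq_eq.1 hδm
  have hden : (3 * (k : ℝ) + 2 * n - 2 - δ) * (3 * (k : ℝ) + 2 * n - 2 + δ) =
      (3 * (k : ℝ) + 2 * n - 2) ^ 2 - (δ : ℝ) ^ 2 := by ring
  have hne : (pathPrefix (n + k) m).Nonempty := ⟨⟨0, by omega⟩, by simp; omega⟩
  have hne' : (pathPrefix (n + k) m)ᶜ.Nonempty := ⟨⟨m, hmN⟩, by simp⟩
  have key (A : Finset (Fin (n + k))) (hA : A.Nonempty) (hA' : Aᶜ.Nonempty)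
      (h0 : ∀ i : Fin (n + k), i.val = 0 → i ∈ A) :
      4 * (3 * (k : ℝ) + 2 * n - 2) / ((3 * (k : ℝ) + 2 * n - 2) ^ 2 - (δ : ℝ) ^ 2) ≤
        wncut (wpathW n k) A := by
    rcases eq_pathPrefix_or_two_le_wcut hA' h0 with ⟨l, hl, hlN, rfl⟩ | hcut
    · have hle : (δ : ℝ) ^ 2 ≤ (pathImbalance n k l : ℝ) ^ 2 := by
        exact_mod_cast Int.natAbs_le_iff_sq_le.1 (hmin l hl hlN)
      have hpos : 0 < wncut (wpathW n k) (pathPrefix (n + k) l) := by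
        have ha := wvol_wpathW_pos hn hk hA
        have hb := wvol_wpathW_pos hn hk hA'
        rw [wncut, wcut_pathPrefix hl hlN]
        positivity
      rw [wncut_pathPrefix hn hk hl hlN] at hpos ⊢
      have hdpos := (div_pos_iff_of_pos_left (by linarith)).1 hpos
      gcongr
    · refine le_trans ?_ (le_wncut_of_two_le_wcut hn hk hA hA' hcut)
      rw [div_le_div_iff₀ (by nlinarith) (by linarith)]
      nlinarith
  rw [hden]
  refine IsLeast.csInf_eq ⟨⟨_, hne, hne', ?_⟩, ?_⟩
  · rw [wncut_pathPrefix hn hk hm hmN, hsq]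
  · rintro _ ⟨A, hA, hA', rfl⟩
    have hzero (B : Finset (Fin (n + k))) (hB : (⟨0, by omega⟩ : Fin (n + k)) ∈ B) :
        ∀ i : Fin (n + k), i.val = 0 → i ∈ B := by
      intro i hi
      have : i = ⟨0, by omega⟩ := Fin.ext hi
      rwa [this]
    by_cases h0 : (⟨0, by omega⟩ : Fin (n + k)) ∈ A
    · exact key A hA hA' (hzero A h0)
    · rw [← wncut_compl (wpathW_comm n k)]
      exact key Aᶜ hA' (by rwa [compl_compl]) (hzero _ (by simpa using h0))

/-- The value of `Mcut(P_{n,k})` for the weighted path, `n, k ≥ 1`,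
`k ≥ (11 − 2n)/3`. -/
theorem mcut_weightedPath (n k : ℕ) (hn : 1 ≤ n) (hk : 1 ≤ k)
    (h : 11 ≤ 3 * k + 2 * n) :
    (((3 ∣ n ∧ 2 ∣ k ∧ 2 * n + 6 < 3 * k) ∨ (4 ∣ (3 * k + 2 * n) ∧ 3 * k ≤ 2 * n)) →
      wmcut (wpathW n k) = 4 / (3 * (k : ℝ) + 2 * n - 2)) ∧
    ((3 ∣ n ∧ ¬ 2 ∣ k ∧ 2 * n + 6 < 3 * k) →
      wmcut (wpathW n k) =
        4 * (3 * (k : ℝ) + 2 * n - 2) /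
          ((3 * (k : ℝ) + 2 * n - 5) * (3 * (k : ℝ) + 2 * n + 1))) ∧
    (((¬ 3 ∣ n ∧ 2 ∣ k ∧ 2 * n + 6 < 3 * k) ∨
        (¬ 4 ∣ (3 * k + 2 * n) ∧ 2 ∣ k ∧ 3 * k ≤ 2 * n)) →
      wmcut (wpathW n k) =
        4 * (3 * (k : ℝ) + 2 * n - 2) /
          ((3 * (k : ℝ) + 2 * n - 4) * (3 * (k : ℝ) + 2 * n))) ∧
    (((¬ 3 ∣ n ∧ ¬ 2 ∣ k ∧ 2 * n + 6 < 3 * k) ∨ (¬ 2 ∣ k ∧ 3 * k ≤ 2 * n)) →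
      wmcut (wpathW n k) =
        4 * (3 * (k : ℝ) + 2 * n - 2) /
          ((3 * (k : ℝ) + 2 * n - 3) * (3 * (k : ℝ) + 2 * n - 1))) ∧
    ((2 * n < 3 * k ∧ 3 * k ≤ 2 * n + 3) →
      wmcut (wpathW n k) =
        (3 * (k : ℝ) + 2 * n - 2) / ((3 * (k : ℝ) - 1) * (2 * (n : ℝ) - 1))) ∧
    ((2 * n + 3 < 3 * k ∧ 3 * k ≤ 2 * n + 6) →
      wmcut (wpathW n k) =
        (2 - 3 * (k : ℝ) - 2 * n) /
          (8 - 6 * (k : ℝ) + 8 * (n : ℝ) - 6 * (k : ℝ) * (n : ℝ))) := by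
  have hV : (3 * (k : ℝ) + 2 * n - 2) ≠ 0 := by
    have : (11 : ℝ) ≤ 3 * k + 2 * n := by exact_mod_cast h
    linarith
  refine ⟨fun hc => ?_, fun hc => ?_, fun hc => ?_, fun hc => ?_, fun hc => ?_, fun hc => ?_⟩
  · obtain ⟨m, hm, hmN, hδ⟩ : ∃ m, 1 ≤ m ∧ m < n + k ∧ pathImbalance n k m = 0 := by
      unfold pathImbalance
      rcases hc with hc | hc
      · exact ⟨(3 * k + 4 * n) / 6, by omega, by omega, by split_ifs <;> omega⟩
      · exact ⟨(3 * k + 2 * n) / 4, by omega, by omega, by split_ifs <;> omega⟩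
    rw [wmcut_wpathW (δ := 0) hn hk h hm hmN (by omega) (by omega) (by omega)]
    push_cast
    rw [sub_zero, add_zero, mul_div_mul_right _ _ hV]
  · rw [wmcut_wpathW (m := (3 * k + 4 * n + 3) / 6) (δ := 3) hn hk h (by omega) (by omega)
      (by unfold pathImbalance; split_ifs <;> omega) (by omega)
      (by intro l _ _; unfold pathImbalance; split_ifs <;> omega)]
    push_cast
    congr 1
    ring
  · obtain ⟨m, hm, hmN, hδ⟩ :
        ∃ m, 1 ≤ m ∧ m < n + k ∧ (pathImbalance n k m).natAbs = 2 := by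
      unfold pathImbalance
      rcases hc with hc | hc
      · have hmod : n % 3 = 1 ∨ n % 3 = 2 := by omega
        exact ⟨(3 * k + 4 * n + 2) / 6, by omega, by omega,
          by rcases hmod with hmod | hmod <;> split_ifs <;> omega⟩
      · exact ⟨(3 * k + 2 * n + 2) / 4, by omega, by omega, by split_ifs <;> omega⟩
    rw [wmcut_wpathW (δ := 2) hn hk h hm hmN (by omega) (by omega)
      (by intro l _ _; unfold pathImbalance; split_ifs <;> omega)]
    push_cast
    congr 1
    ring
  · obtain ⟨m, hm, hmN, hδ⟩ :
        ∃ m, 1 ≤ m ∧ m < n + k ∧ (pathImbalance n k m).natAbs = 1 := by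
      unfold pathImbalance
      rcases hc with hc | hc
      · have hmod : n % 3 = 1 ∨ n % 3 = 2 := by omega
        exact ⟨(3 * k + 4 * n + 1) / 6, by omega, by omega,
          by rcases hmod with hmod | hmod <;> split_ifs <;> omega⟩
      · exact ⟨(3 * k + 2 * n + 1) / 4, by omega, by omega, by split_ifs <;> omega⟩
    rw [wmcut_wpathW (δ := 1) hn hk h hm hmN (by omega) (by omega)
      (by intro l _ _; unfold pathImbalance; split_ifs <;> omega)]
    push_cast
    congr 1
    ring
  · rw [wmcut_wpathW (m := n) (δ := 3 * k - 2 * n) hn hk h (by omega) (by omega)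
      (by unfold pathImbalance; split_ifs <;> omega) (by omega)
      (by intro l _ _; unfold pathImbalance; split_ifs <;> omega),
      ← mul_div_mul_left _ ((3 * (k : ℝ) - 1) * (2 * (n : ℝ) - 1)) four_ne_zero]
    push_cast
    congr 1
    ring
  · rw [wmcut_wpathW (m := n + 1) (δ := 3 * k - 2 * n - 6) hn hk h (by omega) (by omega)
      (by unfold pathImbalance; split_ifs <;> omega) (by omega)
      (by intro l _ _; unfold pathImbalance; split_ifs <;> omega),
      ← mul_div_mul_left (2 - 3 * (k : ℝ) - 2 * n) _ (by norm_num : (-4 : ℝ) ≠ 0)]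
    push_cast
    congr 1 <;> ring
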